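/- Let R be a commutative domain with ring automorphism σ, let H and J be ideals of R, and let G : ℤ →₀ ℤ be a pleasantly alternating cycle. For each n ∈ ℤ set I_n = H[(-G_n)^+] · J[(G_n)^+]. Then I_m · σ^m(I_n) ⊆ I_{m+n} for all m, n ∈ ℤ. (Equivalently, B(G,H,J) = ⊕_n I_n t^n is a subring of R[t, t^{-1}; σ].) -/

import Mathlib

/-- The shift of a cycle: `(shiftCyc j G) i = G (i + j)`, i.e. `σ^j(G)`. -/
def shiftCyc (j : ℤ) (G : ℤ →₀ ℤ) : ℤ →₀ ℤ :=
  Finsupp.equivMapDomain (Equiv.addRight (-j)) G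

/-- The cycles `G_n`: `G_0 = 0`; `G_n = Σ_{j=0}^{n-1} σ^{-j}(G)` for `n ≥ 1`; and
`G_{-n} = -Σ_{j=1}^{n} σ^{j}(G)` for `n ≥ 1`. -/
noncomputable def cyc (G : ℤ →₀ ℤ) (n : ℤ) : ℤ →₀ ℤ :=
  if 0 ≤ n then ∑ j ∈ Finset.range n.toNat, shiftCyc (-(j : ℤ)) G
  else -(∑ j ∈ Finset.Icc 1 (-n).toNat, shiftCyc (j : ℤ) G)

/-- `G` is pleasantly alternating with respect to the interval `[r, s]`. -/
def PleasantlyAlternatingOn (G : ℤ →₀ ℤ) (r s : ℤ) : Prop :=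
  r ≤ s ∧ G r = 1 ∧ G s = 1 ∧
  (∀ i, G i ≠ 0 → r ≤ i ∧ i ≤ s) ∧
  (∀ i, G i = -1 ∨ G i = 0 ∨ G i = 1) ∧
  (∀ i j, i < j → G i ≠ 0 → G j ≠ 0 → (∀ t, i < t → t < j → G t = 0) → G j = -G i)

/-- `G` is pleasantly alternating. -/
def PleasantlyAlternating (G : ℤ →₀ ℤ) : Prop :=
  ∃ r s : ℤ, PleasantlyAlternatingOn G r s

/-- The positive part `D^+ = max(D, 0)` of a cycle, taken pointwise. -/
noncomputable def cycPos (D : ℤ →₀ ℤ) : ℤ →₀ ℤ :=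
  Finsupp.mapRange (fun x => max x 0) (by simp) D

/-- For a cycle `D` with values in `{0, 1}`, `I[D] = ∏_{i : D(i) = 1} σ^i(I)`
(empty product is `R`). -/
noncomputable def idealOf {R : Type*} [CommRing R] (σ : R ≃+* R) (I : Ideal R)
    (D : ℤ →₀ ℤ) : Ideal R :=
  ∏ i ∈ D.support.filter (fun i => D i = 1), Ideal.map (σ ^ i) I

/-- The `n`-th component `I_n = H[(-G_n)^+] · J[(G_n)^+]` of the ring `B(G, H, J)`. -/
noncomputable def BIdeal {R : Type*} [CommRing R] (σ : R ≃+* R) (H J : Ideal R)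
    (G : ℤ →₀ ℤ) (n : ℤ) : Ideal R :=
  idealOf σ H (cycPos (-(cyc G n))) * idealOf σ J (cycPos (cyc G n))

theorem shiftCyc_apply (j : ℤ) (G : ℤ →₀ ℤ) (i : ℤ) : shiftCyc j G i = G (i + j) := by
  simp [shiftCyc, Finsupp.equivMapDomain_apply]

theorem cycPos_apply (D : ℤ →₀ ℤ) (i : ℤ) : cycPos D i = max (D i) 0 := by
  simp [cycPos]

/-- A summatory function of `G` computes every `cyc G n`. -/
theorem cyc_apply_eq_sub {G : ℤ →₀ ℤ} {F : ℤ → ℤ} (hF : ∀ i, F i - F (i - 1) = G i) (n k : ℤ) :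
    cyc G n k = F k - F (k - n) := by
  unfold cyc
  split_ifs with h
  · have key : ∀ N : ℕ, ∑ j ∈ Finset.range N, G (k + -(j : ℤ)) = F k - F (k - N) := by
      intro N
      induction N with
      | zero => simp
      | succ N ih =>
        rw [Finset.sum_range_succ, ih, ← hF]
        push_cast
        ring_nf
    simp only [Finsupp.finsetSum_apply, shiftCyc_apply]
    rw [key, Int.toNat_of_nonneg h]
  · have key : ∀ N : ℕ, ∑ j ∈ Finset.Icc 1 N, G (k + (j : ℤ)) = F (k + N) - F k := by
      intro N
      induction N with
      | zero => simp
      | succ N ih =>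
        rw [Finset.sum_Icc_succ_top (by omega), ih, ← hF]
        push_cast
        ring_nf
    simp only [Finsupp.coe_neg, Pi.neg_apply, Finsupp.finsetSum_apply, shiftCyc_apply]
    rw [key, Int.toNat_of_nonneg (by omega)]
    ring_nf

theorem PleasantlyAlternating.exists_summatory {G : ℤ →₀ ℤ} (hG : PleasantlyAlternating G) :
    ∃ F : ℤ → ℤ, (∀ i, F i - F (i - 1) = G i) ∧ ∀ i, F i = 0 ∨ F i = 1 := by
  obtain ⟨r, s, -, hr, -, hsupp, hval, halt⟩ := hG
  have hstep : ∀ i, r ≤ i →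
      ∑ t ∈ Finset.Icc r i, G t = ∑ t ∈ Finset.Icc r (i - 1), G t + G i := by
    intro i hi
    have : Finset.Icc r i = insert i (Finset.Icc r (i - 1)) := by
      ext t
      simp only [Finset.mem_Icc, Finset.mem_insert]
      omega
    rw [this, Finset.sum_insert (by simp), add_comm]
  refine ⟨fun i => ∑ t ∈ Finset.Icc r i, G t, fun i => ?_, fun i => ?_⟩
  · dsimp only
    rcases le_or_gt r i with hi | hi
    · rw [hstep i hi]
      ring
    · rw [Finset.Icc_eq_empty (by omega), Finset.Icc_eq_empty (by omega)]
      by_contra h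
      have := hsupp i (by simpa [eq_comm] using h)
      omega
  · dsimp only
    rcases lt_or_ge i r with hi | hi
    · simp [Finset.Icc_eq_empty (show ¬ r ≤ i by omega)]
    · suffices ∃ p ≤ i, G p ≠ 0 ∧ G p = 2 * (∑ t ∈ Finset.Icc r i, G t) - 1 ∧
          ∀ t, p < t → t ≤ i → G t = 0 by
        obtain ⟨p, -, h0, hp, -⟩ := this
        have := hval p
        omega
      induction i, hi using Int.leInduction with
      | base => exact ⟨r, le_rfl, by simp [hr], by simp [hr], fun t h h' => by omega⟩
      | succ i hi ih =>
        obtain ⟨p, hpi, h0, hp, hz⟩ := ih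
        rw [hstep (i + 1) (by omega), add_sub_cancel_right]
        by_cases hG0 : G (i + 1) = 0
        · refine ⟨p, by omega, h0, by rw [hp, hG0, add_zero], fun t h h' => ?_⟩
          rcases h'.lt_or_eq with h'' | rfl
          · exact hz t h (by omega)
          · exact hG0
        · have h := halt p (i + 1) (by omega) h0 hG0 fun t h h' => hz t h (by omega)
          exact ⟨i + 1, le_rfl, hG0, by omega, fun t h h' => by omega⟩

theorem cyc_add {G : ℤ →₀ ℤ} (hG : PleasantlyAlternating G) (m n : ℤ) :
    cyc G (m + n) = cyc G m + shiftCyc (-m) (cyc G n) := by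
  obtain ⟨F, hF, -⟩ := hG.exists_summatory
  ext k
  rw [Finsupp.add_apply, shiftCyc_apply]
  simp only [cyc_apply_eq_sub hF]
  ring_nf

theorem cyc_apply_mem_Icc {G : ℤ →₀ ℤ} (hG : PleasantlyAlternating G) (n k : ℤ) :
    cyc G n k ∈ Set.Icc (-1) 1 := by
  obtain ⟨F, hF, h01⟩ := hG.exists_summatory
  have h₁ := h01 k
  have h₂ := h01 (k - n)
  rw [cyc_apply_eq_sub hF, Set.mem_Icc]
  omega

section

variable {R : Type*} [CommRing R] (σ : R ≃+* R)

theorem idealOf_cycPos (I : Ideal R) (D : ℤ →₀ ℤ) {S : Finset ℤ} (hS : D.support ⊆ S) :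
    idealOf σ I (cycPos D) = ∏ i ∈ S, if D i = 1 then Ideal.map (σ ^ i) I else 1 := by
  rw [← Finset.prod_filter, idealOf]
  congr 1
  ext i
  have hi : D i = 1 → i ∈ S := fun h => hS (by simp [h])
  simp only [Finset.mem_filter, Finsupp.mem_support_iff, cycPos_apply]
  constructor
  · rintro ⟨-, h⟩
    have h1 : D i = 1 := by omega
    exact ⟨hi h1, h1⟩
  · rintro ⟨-, h⟩
    simp [h]

theorem map_zpow_idealOf_cycPos (I : Ideal R) (D : ℤ →₀ ℤ) (m : ℤ) :
    Ideal.map (σ ^ m) (idealOf σ I (cycPos D)) = idealOf σ I (cycPos (shiftCyc (-m) D)) := by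
  have hS : (shiftCyc (-m) D).support ⊆ D.support.map (Equiv.addRight m).toEmbedding := by
    intro i hi
    rw [Finsupp.mem_support_iff, shiftCyc_apply] at hi
    exact Finset.mem_map.2 ⟨i + -m, by simpa using hi, by simp⟩
  rw [idealOf_cycPos σ I D subset_rfl, idealOf_cycPos σ I _ hS, Finset.prod_map,
    ← Ideal.mapHom_apply, map_prod]
  refine Finset.prod_congr rfl fun i _ => ?_
  simp only [shiftCyc_apply, Equiv.coe_toEmbedding, Equiv.coe_addRight, add_neg_cancel_right]
  split_ifs
  · rw [Ideal.mapHom_apply, add_comm i m, zpow_add]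
    exact Ideal.map_map ((σ ^ i : R ≃+* R) : R →+* R) ((σ ^ m : R ≃+* R) : R →+* R)
  · exact map_one _

end

/-- `I_m · σ^m(I_n) ⊆ I_{m+n}` for all `m, n ∈ ℤ`; equivalently,
`B(G, H, J) = ⊕_n I_n t^n` is a subring of `R[t, t^{-1}; σ]`. -/
theorem BIdeal_mul_le (R : Type*) [CommRing R] [IsDomain R] (σ : R ≃+* R)
    (H J : Ideal R) (G : ℤ →₀ ℤ) (hG : PleasantlyAlternating G) :
    ∀ m n : ℤ, BIdeal σ H J G m * Ideal.map (σ ^ m) (BIdeal σ H J G n) ≤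
      BIdeal σ H J G (m + n) := by
  intro m n
  simp only [BIdeal, Ideal.map_mul, map_zpow_idealOf_cycPos]
  have hneg : shiftCyc (-m) (-cyc G n) = -shiftCyc (-m) (cyc G n) := by
    ext k
    simp [shiftCyc_apply]
  rw [hneg, cyc_add hG m n]
  have ha : ∀ k, cyc G m k ∈ Set.Icc (-1) 1 := cyc_apply_mem_Icc hG m
  have hb : ∀ k, shiftCyc (-m) (cyc G n) k ∈ Set.Icc (-1) 1 := fun k => by
    rw [shiftCyc_apply]
    exact cyc_apply_mem_Icc hG n _
  generalize cyc G m = A at ha ⊢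
  generalize shiftCyc (-m) (cyc G n) = B at hb ⊢
  have hA : A.support ⊆ A.support ∪ B.support := Finset.subset_union_left
  have hB : B.support ⊆ A.support ∪ B.support := Finset.subset_union_right
  have hAB : (A + B).support ⊆ A.support ∪ B.support := Finsupp.support_add
  rw [idealOf_cycPos σ J A hA, idealOf_cycPos σ J B hB, idealOf_cycPos σ J (A + B) hAB,
    idealOf_cycPos σ H (-A) ((Finsupp.support_neg _).trans_subset hA),
    idealOf_cycPos σ H (-B) ((Finsupp.support_neg _).trans_subset hB),
    idealOf_cycPos σ H (-(A + B)) ((Finsupp.support_neg _).trans_subset hAB)]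
  simp only [← Finset.prod_mul_distrib]
  refine Finset.prod_le_prod' fun k _ => ?_
  obtain ⟨ha₁, ha₂⟩ := ha k
  obtain ⟨hb₁, hb₂⟩ := hb k
  have hak : A k = -1 ∨ A k = 0 ∨ A k = 1 := by omega
  have hbk : B k = -1 ∨ B k = 0 ∨ B k = 1 := by omega
  rcases hak with hak | hak | hak <;> rcases hbk with hbk | hbk | hbk <;>
    simp [hak, hbk, Ideal.one_eq_top]
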